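/- Let L be a finite simplicial complex of dimension k with totally ordered vertices, M ∈ Z_k(L;Z/2) a mod 2 cycle of top degree identified with its support, and Δ a k-simplex of M. Then the cocycle μ ∈ Z^{2k}(OL × L; Z) determined by nonstrict meshing evaluates to 1 on the chain OΔ × M. -/

import Mathlib

open Finset

/-- An abstract simplicial complex on the vertex type `V`: a collection of nonempty
finite subsets of `V` (the simplices, or faces) closed under passing to nonempty subsets. -/
structure SCplx (V : Type) where
  faces : Set (Finset V)
  down_closed : ∀ ⦃s t : Finset V⦄, s ∈ faces → t ⊆ s → t.Nonempty → t ∈ faces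
  nonempty_of_mem : ∀ ⦃s : Finset V⦄, s ∈ faces → s.Nonempty

variable {V : Type}

/-- `L` is a `k`-dimensional complex: every simplex has at most `k+1` vertices and
some simplex has exactly `k+1` vertices. -/
def IsDimOf (L : SCplx V) (k : ℕ) : Prop :=
  (∀ s ∈ L.faces, s.card ≤ k + 1) ∧ ∃ s ∈ L.faces, s.card = k + 1

variable [DecidableEq V] in
/-- A flag complex: every nonempty set of pairwise adjacent vertices spans a simplex. -/
def IsFlag (L : SCplx V) : Prop :=
  ∀ s : Finset V, s.Nonempty →
    (∀ u ∈ s, ∀ w ∈ s, ({u, w} : Finset V) ∈ L.faces) → s ∈ L.faces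

section Oct

variable [DecidableEq V]

/-- The projection `OL → L` on simplices, induced by `V × {±1} → V`
(`Bool` plays the role of `{±1}`, with `false` the minus sign). -/
def pface (s : Finset (V × Bool)) : Finset V := s.image Prod.fst

/-- The octahedralization `OL` of `L`: vertices are doubled, and a set of doubled
vertices spans a simplex iff its first coordinates are distinct and span a simplex of `L`. -/
def oct (L : SCplx V) : SCplx (V × Bool) where
  faces := {s | pface s ∈ L.faces ∧ (pface s).card = s.card}
  down_closed := by
    rintro s t ⟨hf, hc⟩ hts hne
    refine ⟨L.down_closed hf (Finset.image_subset_image hts) ?_, ?_⟩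
    · obtain ⟨x, hx⟩ := hne
      exact ⟨x.1, Finset.mem_image_of_mem _ hx⟩
    · rw [pface, Finset.card_image_iff] at hc ⊢
      exact hc.mono (Finset.coe_subset.mpr hts)
  nonempty_of_mem := by
    rintro s ⟨hf, hc⟩
    by_contra h
    rw [Finset.not_nonempty_iff_eq_empty] at h
    subst h
    simp [pface] at hf
    exact absurd (L.nonempty_of_mem hf) (by simp)

/-- The full subcomplex of `K` on a set `A` of vertices. -/
def fullSub (K : SCplx V) (A : Finset V) : SCplx V where
  faces := {s | s ∈ K.faces ∧ s ⊆ A}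
  down_closed := by
    rintro s t ⟨hs, hA⟩ hts ht
    exact ⟨K.down_closed hs hts ht, hts.trans hA⟩
  nonempty_of_mem := by
    rintro s ⟨hs, -⟩
    exact K.nonempty_of_mem hs

/-- The link of a simplex `σ` in `L`. -/
def scLink (L : SCplx V) (σ : Finset V) : SCplx V where
  faces := {τ | Disjoint σ τ ∧ σ ∪ τ ∈ L.faces ∧ τ.Nonempty}
  down_closed := by
    rintro s t ⟨hd, hf, -⟩ hts ht
    refine ⟨hd.mono_right hts, L.down_closed hf (Finset.union_subset_union (subset_refl σ) hts) ?_, ht⟩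
    obtain ⟨x, hx⟩ := ht
    exact ⟨x, Finset.mem_union_right _ hx⟩
  nonempty_of_mem := by
    rintro s ⟨-, -, h⟩
    exact h

/-- The closed star of a simplex `σ` in `L`; one has `St(σ) = Lk(σ) * σ`. -/
def scStar (L : SCplx V) (σ : Finset V) : SCplx V where
  faces := {τ | τ.Nonempty ∧ σ ∪ τ ∈ L.faces}
  down_closed := by
    rintro s t ⟨-, hf⟩ hts ht
    refine ⟨ht, L.down_closed hf (Finset.union_subset_union (subset_refl σ) hts) ?_⟩
    obtain ⟨x, hx⟩ := ht
    exact ⟨x, Finset.mem_union_right _ hx⟩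
  nonempty_of_mem := by
    rintro s ⟨h, -⟩
    exact h

end Oct

/-- The simplicial join of two complexes. -/
def scJoin {V₁ V₂ : Type} [DecidableEq V₁] [DecidableEq V₂]
    (K₁ : SCplx V₁) (K₂ : SCplx V₂) : SCplx (V₁ ⊕ V₂) where
  faces := {s | s.Nonempty ∧ ∃ (s₁ : Finset V₁) (s₂ : Finset V₂),
    s = s₁.image Sum.inl ∪ s₂.image Sum.inr ∧
    (s₁ = ∅ ∨ s₁ ∈ K₁.faces) ∧ (s₂ = ∅ ∨ s₂ ∈ K₂.faces)}
  down_closed := by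
    rintro s t ⟨hne, s₁, s₂, rfl, h₁, h₂⟩ hts htne
    refine ⟨htne, s₁.filter (fun v => Sum.inl v ∈ t), s₂.filter (fun v => Sum.inr v ∈ t),
      ?_, ?_, ?_⟩
    · ext x
      simp only [Finset.mem_union, Finset.mem_image, Finset.mem_filter]
      constructor
      · intro hx
        have hx' := hts hx
        simp only [Finset.mem_union, Finset.mem_image] at hx'
        rcases hx' with ⟨v, hv, rfl⟩ | ⟨v, hv, rfl⟩
        · exact Or.inl ⟨v, ⟨hv, hx⟩, rfl⟩
        · exact Or.inr ⟨v, ⟨hv, hx⟩, rfl⟩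
      · rintro (⟨v, ⟨hv, hvt⟩, rfl⟩ | ⟨v, ⟨hv, hvt⟩, rfl⟩) <;> assumption
    · by_cases h : s₁.filter (fun v => Sum.inl v ∈ t) = ∅
      · exact Or.inl h
      · right
        rcases h₁ with rfl | h₁
        · simp at h
        · exact K₁.down_closed h₁ (Finset.filter_subset _ _)
            (Finset.nonempty_iff_ne_empty.mpr h)
    · by_cases h : s₂.filter (fun v => Sum.inr v ∈ t) = ∅
      · exact Or.inl h
      · right
        rcases h₂ with rfl | h₂
        · simp at h
        · exact K₂.down_closed h₂ (Finset.filter_subset _ _)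
            (Finset.nonempty_iff_ne_empty.mpr h)
  nonempty_of_mem := by
    rintro s ⟨h, -⟩
    exact h

/-! ### Right-angled Artin groups -/

/-- The standard commutator relators of the right-angled Artin group on the 1-skeleton of `L`. -/
def raagRels [DecidableEq V] (L : SCplx V) : Set (FreeGroup V) :=
  {r | ∃ u w : V, u ≠ w ∧ ({u, w} : Finset V) ∈ L.faces ∧
    r = FreeGroup.of u * FreeGroup.of w * (FreeGroup.of u)⁻¹ * (FreeGroup.of w)⁻¹}

/-- The right-angled Artin group `A_L` associated to a flag complex `L`:
one generator for each vertex, with commuting relations along the edges of `L`. -/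
def RAAG [DecidableEq V] (L : SCplx V) : Type := PresentedGroup (raagRels L)

instance [DecidableEq V] (L : SCplx V) : Group (RAAG L) :=
  inferInstanceAs (Group (PresentedGroup (raagRels L)))

/-! ### Geometric realization -/

/-- The standard basis vertex placement for the geometric realization. -/
def stdVert [DecidableEq V] (v : V) : V → ℝ := fun w => if w = v then 1 else 0

/-- The geometric realization of an abstract simplicial complex, inside `V → ℝ`. -/
def realization [DecidableEq V] (L : SCplx V) : Set (V → ℝ) :=
  ⋃ s ∈ L.faces, convexHull ℝ (stdVert '' (s : Set V))

/-! ### Action dimension and geometric dimension -/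

/-- The action dimension of a group `Γ`: the least dimension of a contractible
(topological) manifold admitting a proper (i.e. properly discontinuous, by
homeomorphisms) `Γ`-action; `⊤` if there is no such manifold. -/
noncomputable def actdim (Γ : Type) [Group Γ] : ℕ∞ :=
  sInf {n : ℕ∞ | ∃ m : ℕ, n = (m : ℕ∞) ∧
    ∃ (M : Type) (_ : TopologicalSpace M) (_ : T2Space M)
      (_ : ChartedSpace (EuclideanSpace ℝ (Fin m)) M) (ρ : Γ →* Equiv.Perm M),
      ContractibleSpace M ∧ (∀ γ : Γ, Continuous (⇑(ρ γ) : M → M)) ∧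
      ∀ K L : Set M, IsCompact K → IsCompact L →
        {γ : Γ | ((⇑(ρ γ) : M → M) '' K ∩ L).Nonempty}.Finite}

/-- The geometric dimension of a group `Γ`: the least dimension of a (simplicial) model
for the classifying space `BΓ`, i.e. the least `m` such that `Γ` acts freely simplicially on
an `m`-dimensional contractible simplicial complex; `⊤` if there is no finite-dimensional
model. -/
noncomputable def gd (Γ : Type) [Group Γ] : ℕ∞ :=
  sInf {n : ℕ∞ | ∃ m : ℕ, n = (m : ℕ∞) ∧
    ∃ (W : Type) (_ : DecidableEq W) (X : SCplx W) (ρ : Γ →* Equiv.Perm W),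
      (∀ (γ : Γ), ∀ s ∈ X.faces, s.image (ρ γ) ∈ X.faces) ∧
      (∀ (γ : Γ), γ ≠ 1 → ∀ s ∈ X.faces, s.image (ρ γ) ≠ s) ∧
      (∀ s ∈ X.faces, s.card ≤ m + 1) ∧
      ContractibleSpace (realization X)}

/-! ### PL embeddings and embedding dimension -/

/-- A compact polyhedron in a real vector space: a finite union of polytopes. -/
def IsCompactPolyhedron {E : Type*} [AddCommGroup E] [Module ℝ E] (S : Set E) : Prop :=
  ∃ F : Finset (Finset E), S = ⋃ t ∈ F, convexHull ℝ (t : Set E)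

/-- A piecewise linear embedding of the compact polyhedron `P` into `Q`: an injective
map `P → Q` whose graph is a compact polyhedron. -/
def HasPLEmbedding {E₁ E₂ : Type*} [AddCommGroup E₁] [Module ℝ E₁]
    [AddCommGroup E₂] [Module ℝ E₂] (P : Set E₁) (Q : Set E₂) : Prop :=
  ∃ f : E₁ → E₂, Set.InjOn f P ∧ f '' P ⊆ Q ∧
    IsCompactPolyhedron {p : E₁ × E₂ | p.1 ∈ P ∧ p.2 = f p.1}

/-- The boundary complex of the `(m+1)`-simplex, a standard PL `m`-sphere. -/
def sphereCplx (m : ℕ) : SCplx (Fin (m + 2)) where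
  faces := {s | s.Nonempty ∧ s ≠ Finset.univ}
  down_closed := by
    rintro s t ⟨-, hs⟩ hts ht
    refine ⟨ht, fun h => hs ?_⟩
    exact Finset.univ_subset_iff.mp (h ▸ hts)
  nonempty_of_mem := fun _ h => h.1

/-- `K` embeds piecewise linearly in the sphere `S^m`. -/
def PLEmbedsInSphere [DecidableEq V] (K : SCplx V) (m : ℕ) : Prop :=
  HasPLEmbedding (realization K) (realization (sphereCplx m))

/-- The embedding dimension of `K`: the least `m` such that `K` piecewise linearly
embeds in `S^m`. -/
noncomputable def embdim [DecidableEq V] (K : SCplx V) : ℕ :=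
  sInf {m | PLEmbedsInSphere K m}

/-! ### Simplicial chains and homology mod 2 -/

/-- A simplicial `k`-chain with `ℤ/2` coefficients on `L`, recorded as its coefficient
function on finite vertex sets: it is supported on the `k`-simplices of `L`. -/
def IsChainOn (L : SCplx V) (k : ℕ) (c : Finset V → ZMod 2) : Prop :=
  ∀ s, c s ≠ 0 → s ∈ L.faces ∧ s.card = k + 1

/-- The mod 2 simplicial boundary operator (the coefficient of `∂c` on `t` is the sum
of the coefficients of `c` over the cofaces of `t`). -/
noncomputable def bd2 [Fintype V] [DecidableEq V] (c : Finset V → ZMod 2) :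
    Finset V → ZMod 2 :=
  fun t => ∑ x ∈ tᶜ, c (insert x t)

/-- `c` is a mod 2 simplicial `k`-cycle on `L`. -/
def IsCycleOn [Fintype V] [DecidableEq V] (L : SCplx V) (k : ℕ)
    (c : Finset V → ZMod 2) : Prop :=
  IsChainOn L k c ∧ ∀ t : Finset V, t.Nonempty → bd2 c t = 0

/-- `H_k(L; ℤ/2) ≠ 0`: there is a mod 2 `k`-cycle which is not a boundary. -/
def ModTwoHomologyNonzero [Fintype V] [DecidableEq V] (L : SCplx V) (k : ℕ) : Prop :=
  ∃ c, IsCycleOn L k c ∧ ¬∃ d, IsChainOn L (k + 1) d ∧ bd2 d = c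

/-! ### The van Kampen obstruction -/

/-- An (ordered) cell `σ × τ` of the simplicial deleted product of `K`. -/
def IsCell {W : Type} (K : SCplx W) (σ τ : Finset W) : Prop :=
  σ ∈ K.faces ∧ τ ∈ K.faces ∧ Disjoint σ τ

/-- An equivariant, augmentation-preserving chain map (mod 2) from the cellular chains of the
simplicial deleted product of `K` to the standard free resolution `W_*` of `ℤ/2` over
`ℤ/2[ℤ/2]` (the cellular chains of `S^∞ = EZ/2`); such a map classifies the free involution.
The value on a cell `(σ,τ)` is the pair of coefficients of `e_n` and `Te_n`, `n = dim σ×τ`. -/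
structure VKMap {W : Type} [DecidableEq W] (K : SCplx W) where
  f : Finset W × Finset W → ZMod 2 × ZMod 2
  supp : ∀ p : Finset W × Finset W, ¬ IsCell K p.1 p.2 → f p = 0
  symm : ∀ σ τ : Finset W, f (τ, σ) = (f (σ, τ)).swap
  aug : ∀ v w : W, IsCell K {v} {w} → (f ({v}, {w})).1 + (f ({v}, {w})).2 = 1
  chain : ∀ σ τ : Finset W, IsCell K σ τ → 3 ≤ σ.card + τ.card →
    ((∑ x ∈ σ, f (σ.erase x, τ)) + (∑ x ∈ τ, f (σ, τ.erase x))) =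
      ((f (σ, τ)).1 + (f (σ, τ)).2, (f (σ, τ)).1 + (f (σ, τ)).2)

/-- The pullback under `Φ` of the standard cocycle representing `w_1^m` on `RP^∞` is a
coboundary in the complex of symmetric (= `ℤ/2`-equivariant) cochains on the deleted
product, i.e. the class `vk^m_{ℤ/2}(K) = c^*(w_1^m) ∈ H^m(C(K); ℤ/2)` vanishes. -/
def vkClassVanishes {W : Type} [DecidableEq W] (K : SCplx W) (Φ : VKMap K) (m : ℕ) : Prop :=
  ∃ η : Finset W × Finset W → ZMod 2,
    (∀ p : Finset W × Finset W, ¬ IsCell K p.1 p.2 → η p = 0) ∧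
    (∀ σ τ : Finset W, η (τ, σ) = η (σ, τ)) ∧
    ∀ σ τ : Finset W, IsCell K σ τ → σ.card + τ.card = m + 2 →
      ((∑ x ∈ σ, η (σ.erase x, τ)) + (∑ x ∈ τ, η (σ, τ.erase x))) =
        (Φ.f (σ, τ)).1 + (Φ.f (σ, τ)).2

/-- Nonvanishing of the mod 2 van Kampen obstruction
`vk^m_{ℤ/2}(K) = c^*(w_1^m) ∈ H^m(C(K); ℤ/2)`. -/
def vkModTwoNonzero {W : Type} [DecidableEq W] (K : SCplx W) (m : ℕ) : Prop :=
  ∃ Φ : VKMap K, ¬ vkClassVanishes K Φ m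

/-- The van Kampen dimension of `K`: the largest `m` with `vk^m_{ℤ/2}(K) ≠ 0`
(with the usual conventions `vkdim ∅ = -2` and `vkdim(point) = -1`). -/
noncomputable def vkdim {W : Type} [DecidableEq W] (K : SCplx W) : ℤ :=
  sSup ({-2} ∪ {m : ℤ | (m = -1 ∧ K.faces.Nonempty) ∨
    ∃ n : ℕ, m = (n : ℤ) ∧ vkModTwoNonzero K n})

/-! ### The integral van Kampen obstruction -/

open Classical in
/-- The sign `(-1)^i` where `i` is the position of `x` in the simplex `σ` ordered by `lt`. -/
noncomputable def osign' {W : Type} (lt : W → W → Prop) (σ : Finset W) (x : W) : ℤ :=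
  (-1) ^ (σ.filter (fun y => lt y x)).card

/-- An equivariant, augmentation-preserving integral chain map from the cellular chains of
the simplicial deleted product of `K` (cells oriented by the order `lt`, the involution acting
with the sign `(-1)^{dim σ · dim τ}`) to the standard free resolution `W_*` of `ℤ` over
`ℤ[ℤ/2]` (with `∂e_n = e_{n-1} + (-1)^n Te_{n-1}`). -/
structure VKMapZ {W : Type} [DecidableEq W] (K : SCplx W) (lt : W → W → Prop) where
  f : Finset W × Finset W → ℤ × ℤ
  supp : ∀ p : Finset W × Finset W, ¬ IsCell K p.1 p.2 → f p = 0
  symm : ∀ σ τ : Finset W,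
    f (τ, σ) = ((-1 : ℤ) ^ ((σ.card - 1) * (τ.card - 1))) • (f (σ, τ)).swap
  aug : ∀ v w : W, IsCell K {v} {w} → (f ({v}, {w})).1 + (f ({v}, {w})).2 = 1
  chain : ∀ σ τ : Finset W, IsCell K σ τ → 3 ≤ σ.card + τ.card →
    ((∑ x ∈ σ, osign' lt σ x • f (σ.erase x, τ)) +
      ((-1 : ℤ) ^ (σ.card - 1)) • ∑ x ∈ τ, osign' lt τ x • f (σ, τ.erase x)) =
      ((f (σ, τ)).1 + (-1 : ℤ) ^ (σ.card + τ.card) * (f (σ, τ)).2,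
       (-1 : ℤ) ^ (σ.card + τ.card) * (f (σ, τ)).1 + (f (σ, τ)).2)

/-- The integral van Kampen class `vk^m(K) = c^*(e_1^m) ∈ H^m(C(K); ℤ)` (in even degree `m`)
vanishes: the pullback under `Φ` of the standard invariant cocycle generating
`H^m(RP^∞;ℤ)` is a coboundary of an invariant integral cochain. -/
def vkZClassVanishes {W : Type} [DecidableEq W] (K : SCplx W) (lt : W → W → Prop)
    (Φ : VKMapZ K lt) (m : ℕ) : Prop :=
  ∃ η : Finset W × Finset W → ℤ,
    (∀ p : Finset W × Finset W, ¬ IsCell K p.1 p.2 → η p = 0) ∧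
    (∀ σ τ : Finset W, η (τ, σ) = ((-1 : ℤ) ^ ((σ.card - 1) * (τ.card - 1))) * η (σ, τ)) ∧
    ∀ σ τ : Finset W, IsCell K σ τ → σ.card + τ.card = m + 2 →
      ((∑ x ∈ σ, osign' lt σ x * η (σ.erase x, τ)) +
        ((-1 : ℤ) ^ (σ.card - 1)) * ∑ x ∈ τ, osign' lt τ x * η (σ, τ.erase x)) =
        (Φ.f (σ, τ)).1 + (Φ.f (σ, τ)).2

/-- Nonvanishing of the integral van Kampen obstruction `vk^m(K) ∈ H^m(C(K); ℤ)`
(`m` even). -/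
def vkZNonzero {W : Type} [DecidableEq W] (K : SCplx W) (lt : W → W → Prop) (m : ℕ) : Prop :=
  ∃ Φ : VKMapZ K lt, ¬ vkZClassVanishes K lt Φ m

/-! ### Orders and meshing -/

/-- The order on the doubled vertices `V × {±1}`: `v⁻ < v⁺ < w⁻ < w⁺ < ⋯` for `v < w`
(`false` is the minus sign). -/
def olt [LT V] (a b : V × Bool) : Prop :=
  a.1 < b.1 ∨ (a.1 = b.1 ∧ a.2 = false ∧ b.2 = true)

/-- The reflexive closure of `olt`. -/
def ole [LT V] (a b : V × Bool) : Prop := olt a b ∨ a = b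

/-- `Meshed r s [v₀,…,v_k] [w₀,…,w_k]` says `r v₀ w₀`, `s w₀ v₁`, `r v₁ w₁`, `s w₁ v₂`, … ,
`r v_k w_k`, i.e. the two vertex lists alternate with respect to the relations `r`, `s`. -/
def Meshed {α : Type*} (r s : α → α → Prop) : List α → List α → Prop
  | [a], [b] => r a b
  | a :: a' :: l₁, b :: l₂ => r a b ∧ s b a' ∧ Meshed r s (a' :: l₁) l₂
  | _, _ => False

/-- `l` is the enumeration of the finite set `σ` in increasing order w.r.t. `r`. -/
def SListOf {α : Type*} [DecidableEq α] (r : α → α → Prop) (l : List α) (σ : Finset α) : Prop :=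
  l.toFinset = σ ∧ l.Chain' r

open Classical in
/-- The standard integral cocycle `ν` representing the top-degree van Kampen obstruction:
on an oriented cell `[σ,τ]` of `C(OL)` (simplices oriented by increasing vertex order)
it is `1` if `σ,τ` mesh, `(-1)^k` if `τ,σ` mesh, `0` otherwise. -/
noncomputable def nuVal [LinearOrder V] (k : ℕ) (σ τ : Finset (V × Bool)) : ℤ :=
  if ∃ l₁ l₂ : List (V × Bool), SListOf olt l₁ σ ∧ SListOf olt l₂ τ ∧ Meshed olt olt l₁ l₂
  then 1
  else if ∃ l₁ l₂ : List (V × Bool), SListOf olt l₁ σ ∧ SListOf olt l₂ τ ∧ Meshed olt olt l₂ l₁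
  then (-1) ^ k
  else 0

open Classical in
/-- The cocycle `μ ∈ Z^{2k}(OL × L; ℤ)`: its value on a cell `(σ, b)` is `1` if
`σ` meshes nonstrictly with the minus-copy `b⁻` of `b` (that is,
`v₀ ≤ w₀⁻ < v₁ ≤ w₁⁻ < ⋯ ≤ w_k⁻`), and `0` otherwise. -/
noncomputable def muVal [LinearOrder V] (σ : Finset (V × Bool)) (b : Finset V) : ℤ :=
  if ∃ (l₁ : List (V × Bool)) (l₂ : List V), SListOf olt l₁ σ ∧
      l₂.toFinset = b ∧ l₂.Chain' (· < ·) ∧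
      Meshed ole olt l₁ (l₂.map (fun w => (w, false)))
  then 1 else 0

/-! ### The chains `Ω`, `s_*`, and `OΔ × M` -/

open Classical in
/-- The vertices of (the support of) a mod 2 cycle `M`. -/
noncomputable def cycVerts [Fintype V] [DecidableEq V] (M : Finset V → ZMod 2) : Finset V :=
  Finset.univ.filter (fun v => ∃ s, M s ≠ 0 ∧ v ∈ s)

/-- The vertex set `M⁻ ∪ {v₀^±, …, v_k^±}` of `D`, the complex `M` doubled over `Δ`. -/
noncomputable def doubledVerts [Fintype V] [DecidableEq V] (M : Finset V → ZMod 2)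
    (Δ : Finset V) : Finset (V × Bool) :=
  (cycVerts M).image (fun v => (v, false)) ∪ Δ.image (fun v => (v, false)) ∪
    Δ.image (fun v => (v, true))

open Classical in
/-- The mod 2 chain `Ω ∈ C_{2k}(C(D); ℤ/2)` (as a symmetric function on ordered pairs):
a `2k`-cell `[σ,τ]` of `C(D)` lies in `Ω` iff `σ ∩ τ = ∅` and `Δ⁰ ⊆ p(σ) ∪ p(τ)`. -/
noncomputable def OmegaChain [DecidableEq V] (D : SCplx (V × Bool)) (Δ : Finset V) (k : ℕ) :
    Finset (V × Bool) × Finset (V × Bool) → ZMod 2 :=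
  fun p => if IsCell D p.1 p.2 ∧ p.1.card + p.2.card = 2 * k + 2 ∧
      Δ ⊆ pface p.1 ∪ pface p.2 then 1 else 0

open Classical in
/-- The pushforward under the chain map
`s : C_*(C(OL)) → C_*(OL × L)`, `[σ,τ] ↦ (σ, p(τ)) + (τ, p(σ))` (mod 2), of a mod 2 chain on
`C(OL)` given as a symmetric function on ordered pairs. -/
noncomputable def pushS [Fintype V] [DecidableEq V]
    (c : Finset (V × Bool) × Finset (V × Bool) → ZMod 2) :
    Finset (V × Bool) × Finset V → ZMod 2 :=
  fun q => ∑ τ : Finset (V × Bool), if pface τ = q.2 then c (q.1, τ) else 0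

open Classical in
/-- The mod 2 chain `OΔ × M ∈ C_{2k}(OL × L; ℤ/2)`. -/
noncomputable def chODeltaM [DecidableEq V] (Δ : Finset V) (M : Finset V → ZMod 2) (k : ℕ) :
    Finset (V × Bool) × Finset V → ZMod 2 :=
  fun q => if pface q.1 = Δ ∧ q.1.card = k + 1 then M q.2 else 0

/-- The mod 2 cellular boundary operator on chains of the configuration space `C(D)`
(symmetric functions on ordered pairs): `∂(σ × τ) = ∂σ × τ + σ × ∂τ`. -/
noncomputable def cBd2 [Fintype V] [DecidableEq V]
    (c : Finset (V × Bool) × Finset (V × Bool) → ZMod 2) :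
    Finset (V × Bool) × Finset (V × Bool) → ZMod 2 :=
  fun p => (∑ x ∈ p.1ᶜ, c (insert x p.1, p.2)) + (∑ x ∈ p.2ᶜ, c (p.1, insert x p.2))

/-- The `*`-condition for `(M, Δ)`: for all simplices `σ, τ` of `M` with
`Δ⁰ ⊆ σ ∪ τ` one has `σ ∩ τ ⊆ Δ`. -/
def StarCond [DecidableEq V] (M : Finset V → ZMod 2) (Δ : Finset V) : Prop :=
  ∀ σ τ : Finset V, M σ ≠ 0 → M τ ≠ 0 → Δ ⊆ σ ∪ τ → σ ∩ τ ⊆ Δ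

/-! ### Rational (reduced) simplicial homology -/

/-- The augmented rational simplicial boundary operator, on coefficient functions
`Finset V → ℚ` (the empty set plays the role of the `(-1)`-simplex, so this computes
reduced homology). -/
noncomputable def bdQ [Fintype V] [DecidableEq V] [LinearOrder V] :
    (Finset V → ℚ) →ₗ[ℚ] (Finset V → ℚ) where
  toFun c := fun t => ∑ x ∈ tᶜ, ((-1 : ℚ) ^ (t.filter (· < x)).card) * c (insert x t)
  map_add' a b := by
    funext t
    simp [mul_add, Finset.sum_add_distrib]
  map_smul' r a := by
    funext t
    simp only [RingHom.id_apply, Pi.smul_apply, smul_eq_mul]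
    rw [Finset.mul_sum]
    exact Finset.sum_congr rfl (fun x _ => by ring)

/-- The submodule of rational `k`-chains on `L`. -/
def chainsQ (L : SCplx V) (k : ℕ) : Submodule ℚ (Finset V → ℚ) where
  carrier := {c | ∀ s, c s ≠ 0 → s ∈ L.faces ∧ s.card = k + 1}
  add_mem' := by
    intro a b ha hb s hs
    by_cases h1 : a s = 0
    · by_cases h2 : b s = 0
      · exact absurd (by simp [h1, h2]) hs
      · exact hb s h2
    · exact ha s h1
  zero_mem' := by intro s hs; simp at hs
  smul_mem' := by
    intro r a ha s hs
    refine ha s (fun h => hs ?_)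
    simp [h]

/-- The reduced rational Betti number `b̄_k(L) = dim_ℚ H̃_k(L; ℚ)`. -/
noncomputable def redBetti [Fintype V] [DecidableEq V] [LinearOrder V]
    (L : SCplx V) (k : ℕ) : ℕ :=
  Module.finrank ℚ
    ((chainsQ L k ⊓ LinearMap.ker bdQ : Submodule ℚ (Finset V → ℚ)) ⧸
      (Submodule.comap (chainsQ L k ⊓ LinearMap.ker bdQ).subtype
        (Submodule.map bdQ (chainsQ L (k + 1)))))

/-! ### Integral simplicial cohomology in the top degree -/

open Classical in
/-- The integral simplicial coboundary operator into degree `k` cochains on `L`. -/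
noncomputable def cobOn [Fintype V] [DecidableEq V] [LinearOrder V] (L : SCplx V) (k : ℕ) :
    (Finset V → ℤ) →ₗ[ℤ] (Finset V → ℤ) where
  toFun φ := fun s => if s ∈ L.faces ∧ s.card = k + 1 then
      ∑ x ∈ s, ((-1 : ℤ) ^ (s.filter (· < x)).card) * φ (s.erase x) else 0
  map_add' a b := by
    funext s
    by_cases h : s ∈ L.faces ∧ s.card = k + 1 <;>
      simp [h, mul_add, Finset.sum_add_distrib]
  map_smul' r a := by
    funext s
    simp only [RingHom.id_apply, Pi.smul_apply, smul_eq_mul]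
    by_cases h : s ∈ L.faces ∧ s.card = k + 1
    · rw [if_pos h, if_pos h, Finset.mul_sum]
      exact Finset.sum_congr rfl (fun x _ => by ring)
    · rw [if_neg h, if_neg h, mul_zero]

/-- The submodule of integral `k`-cochains on `L` (functions supported on `k`-simplices). -/
def cochainsZ (L : SCplx V) (k : ℕ) : Submodule ℤ (Finset V → ℤ) where
  carrier := {c | ∀ s, c s ≠ 0 → s ∈ L.faces ∧ s.card = k + 1}
  add_mem' := by
    intro a b ha hb s hs
    by_cases h1 : a s = 0
    · by_cases h2 : b s = 0
      · exact absurd (by simp [h1, h2]) hs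
      · exact hb s h2
    · exact ha s h1
  zero_mem' := by intro s hs; simp at hs
  smul_mem' := by
    intro r a ha s hs
    refine ha s (fun h => hs ?_)
    simp [h]

open Classical in
/-- The submodule of integral `k`-coboundaries on `L`. -/
noncomputable def cobndZ [Fintype V] [DecidableEq V] [LinearOrder V]
    (L : SCplx V) (k : ℕ) : Submodule ℤ (Finset V → ℤ) :=
  if k = 0 then ⊥ else Submodule.map (cobOn L k) (cochainsZ L (k - 1))

/-- The top-degree integral simplicial cohomology `H^k(L; ℤ)` (for `k = dim L` every
`k`-cochain is a cocycle). -/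
noncomputable def topCohomologyZ [Fintype V] [DecidableEq V] [LinearOrder V]
    (L : SCplx V) (k : ℕ) :=
  (cochainsZ L k) ⧸ (Submodule.comap (cochainsZ L k).subtype (cobndZ L k))

noncomputable instance [Fintype V] [DecidableEq V] [LinearOrder V] (L : SCplx V) (k : ℕ) :
    AddCommGroup (topCohomologyZ L k) :=
  inferInstanceAs (AddCommGroup ((cochainsZ L k) ⧸
    (Submodule.comap (cochainsZ L k).subtype (cobndZ L k))))

/-- A space is aspherical if it admits a contractible covering space. -/
def IsAspherical (X : Type) [TopologicalSpace X] : Prop :=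
  ∃ (Y : Type) (_ : TopologicalSpace Y) (f : Y → X), IsCoveringMap f ∧ ContractibleSpace Y


theorem aux_olt_irrefl {V : Type} [LinearOrder V] (a : V × Bool) : ¬ olt a a := by
  rintro (h | ⟨_, h, h'⟩)
  · exact lt_irrefl _ h
  · simp_all

theorem aux_olt_trans {V : Type} [LinearOrder V] {a b c : V × Bool}
    (h : olt a b) (h' : olt b c) : olt a c := by
  rcases h with h | ⟨h1, h2, h3⟩ <;> rcases h' with h' | ⟨h1', h2', h3'⟩
  · exact Or.inl (h.trans h')
  · exact Or.inl (h1' ▸ h)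
  · exact Or.inl (h1 ▸ h')
  · simp_all

theorem aux_uniq {α : Type*} (r : α → α → Prop) (hi : ∀ a, ¬ r a a)
    (ht : ∀ {a b c}, r a b → r b c → r a c) {l l' : List α}
    (h : l.IsChain r) (h' : l'.IsChain r) (hm : ∀ x, x ∈ l ↔ x ∈ l') : l = l' := by
  classical
  haveI : IsTrans α r := ⟨fun _ _ _ => ht⟩
  have p := List.isChain_iff_pairwise.1 h
  have p' := List.isChain_iff_pairwise.1 h'
  have n : l.Nodup := List.Pairwise.imp (fun {a b} hab (e : a = b) => hi a (by rw [← e] at hab; exact hab)) p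
  have n' : l'.Nodup := List.Pairwise.imp (fun {a b} hab (e : a = b) => hi a (by rw [← e] at hab; exact hab)) p'
  have hp : l.Perm l' := (List.perm_ext_iff_of_nodup n n').2 hm
  exact hp.eq_of_pairwise (fun a b _ _ hab hba => absurd (ht hab hba) (hi a)) p p'

/-- The list of signed vertices, with plus signs exactly on `T`. -/
def sgnList {V : Type} [LinearOrder V] (T : Finset V) (l : List V) : List (V × Bool) :=
  l.map (fun v => (v, decide (v ∈ T)))

open Classical in
theorem aux_mu {V : Type} [LinearOrder V] (T Δ b : Finset V) :
    muVal (Δ.image (fun v => (v, decide (v ∈ T)))) b =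
      if Meshed ole olt (sgnList T (Δ.sort (· ≤ ·)))
        ((b.sort (· ≤ ·)).map (fun w => (w, false))) then 1 else 0 := by
  unfold muVal
  have hD : (sgnList T (Δ.sort (· ≤ ·))).IsChain olt := by
    unfold sgnList
    rw [List.isChain_map]
    exact (Δ.sortedLT_sort).isChain.imp (fun {a b} h => Or.inl h)
  have hB : (b.sort (· ≤ ·)).IsChain (· < ·) := (b.sortedLT_sort).isChain
  congr 1
  apply propext
  constructor
  · rintro ⟨l₁, l₂, ⟨h1, h2⟩, h3, h4, h5⟩
    have e1 : l₁ = sgnList T (Δ.sort (· ≤ ·)) := by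
      refine aux_uniq olt aux_olt_irrefl aux_olt_trans h2 hD (fun x => ?_)
      rw [← List.mem_toFinset, h1]
      simp [sgnList]
    have e2 : l₂ = b.sort (· ≤ ·) := by
      refine aux_uniq (· < ·) (fun a => lt_irrefl a) (fun h h' => lt_trans h h') h4 hB (fun x => ?_)
      rw [← List.mem_toFinset, h3]
      simp
    rw [← e1, ← e2]
    exact h5
  · intro h
    refine ⟨_, _, ⟨?_, hD⟩, ?_, hB, h⟩
    · ext x; simp [sgnList]
    · simp

theorem aux_sgn_insert {V : Type} [LinearOrder V] (T : Finset V) (v : V) (l : List V)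
    (h : v ∉ l) : sgnList (insert v T) l = sgnList T l := by
  unfold sgnList
  apply List.map_congr_left
  intro a ha
  have : a ≠ v := fun e => h (e ▸ ha)
  simp [this]

open Classical in
theorem aux_count {V : Type} [LinearOrder V] : ∀ (D B : List V), D ≠ [] →
    D.length = B.length → D.IsChain (· < ·) → B.IsChain (· < ·) →
    ∑ T ∈ D.toFinset.powerset,
      (if Meshed ole olt (sgnList T D) (B.map (fun w => (w, false))) then (1 : ZMod 2) else 0)
      = if D = B then 1 else 0
  | [], _, h, _, _, _ => absurd rfl h
  | v :: D, [], _, h, _, _ => by simp at h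
  | v :: D, w :: B, _, hl, hD, hB => by
    have hp := List.isChain_iff_pairwise.1 hD
    have hv : v ∉ D := fun h => lt_irrefl _ ((List.pairwise_cons.1 hp).1 v h)
    have hv' : v ∉ D.toFinset := by simpa using hv
    rw [List.toFinset_cons, Finset.sum_powerset_insert hv', ← Finset.sum_add_distrib]
    have key : ∀ T ∈ D.toFinset.powerset,
        sgnList T (v :: D) = (v, false) :: sgnList T D ∧
        sgnList (insert v T) (v :: D) = (v, true) :: sgnList T D := by
      intro T hT
      have : v ∉ T := fun h => hv' (Finset.mem_powerset.1 hT h)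
      refine ⟨by simp [sgnList, this], ?_⟩
      have h2 := aux_sgn_insert T v D hv
      simp only [sgnList] at h2 ⊢
      rw [List.map_cons, h2]
      simp
    rw [Finset.sum_congr rfl (fun T hT => by rw [(key T hT).1, (key T hT).2])]
    match D, B, hl with
    | [], [], _ =>
      rcases lt_trichotomy v w with h | h | h
      · have : (1 : ZMod 2) + 1 = 0 := by decide
        simp [sgnList, Meshed, ole, olt, h, h.ne, this]
      · subst h
        simp [sgnList, Meshed, ole, olt]
      · simp [sgnList, Meshed, ole, olt, h.not_gt, h.ne']
    | v' :: D, w' :: B, hl =>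
      have hvv : v < v' := (List.pairwise_cons.1 hp).1 v' (by simp)
      have ih := aux_count (v' :: D) (w' :: B) (by simp) (by simpa using hl)
        hD.tail hB.tail
      have e : ∀ s T, Meshed ole olt ((v, s) :: sgnList T (v' :: D))
          ((w :: w' :: B).map (fun w => (w, false))) ↔
          ole (v, s) (w, false) ∧ olt (w, false) (v', decide (v' ∈ T)) ∧
          Meshed ole olt (sgnList T (v' :: D)) ((w' :: B).map (fun w => (w, false))) := by
        intro s T
        simp [sgnList, Meshed]
      simp only [e]
      rcases lt_trichotomy v w with h | h | h
      · have h1 : ∀ s, ole (v, s) (w, false) := fun s => Or.inl (Or.inl h)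
        have : ∀ x : ZMod 2, x + x = 0 := by decide
        simp [h1, this, h.ne]
      · subst h
        have h1 : ole (v, false) (v, false) := Or.inr rfl
        have h2 : ¬ ole (v, true) (v, false) := by simp [ole, olt]
        have h3 : ∀ s, olt (v, false) (v', s) := fun s => Or.inl hvv
        simp only [h1, h2, h3, true_and, false_and, if_false, add_zero]
        rw [ih]
        simp
      · have h1 : ∀ s, ¬ ole (v, s) (w, false) := by
          intro s; simp [ole, olt, h.not_gt, h.ne']
        simp [h1, h.ne']

theorem aux_sum {V : Type} [Fintype V] [LinearOrder V] (Δ b : Finset V) (k : ℕ)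
    (hΔ : Δ.card = k + 1) (hb : b.card = k + 1) :
    ∑ α ∈ (Finset.univ : Finset (Finset (V × Bool))).filter
        (fun α => pface α = Δ ∧ α.card = k + 1), ((muVal α b : ℤ) : ZMod 2)
      = if Δ = b then 1 else 0 := by
  classical
  have h := aux_count (Δ.sort (· ≤ ·)) (b.sort (· ≤ ·))
    (by intro h; have := congrArg List.length h; simp [hΔ] at this)
    (by simp [hΔ, hb]) Δ.sortedLT_sort.isChain b.sortedLT_sort.isChain
  have e : (Δ.sort (· ≤ ·) = b.sort (· ≤ ·)) ↔ Δ = b := by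
    refine ⟨fun h => ?_, fun h => by rw [h]⟩
    rw [← Finset.sort_toFinset (r := (· ≤ ·)) Δ, h, Finset.sort_toFinset]
  rw [Finset.sort_toFinset] at h
  simp only [e] at h
  rw [← h]
  symm
  refine Finset.sum_bij' (fun T _ => Δ.image (fun v => (v, decide (v ∈ T))))
    (fun α _ => Δ.filter (fun v => (v, true) ∈ α)) ?_ ?_ ?_ ?_ ?_
  · intro T hT
    rw [Finset.mem_filter]
    refine ⟨Finset.mem_univ _, ?_, ?_⟩
    · ext x; simp [pface]
    · rw [Finset.card_image_of_injective _ (fun a b hab => (Prod.mk.inj hab).1), hΔ]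
  · intro α _
    simp
  · intro T hT
    have := Finset.mem_powerset.1 hT
    ext x
    simp only [Finset.mem_filter, Finset.mem_image, Prod.mk.injEq, decide_eq_true_eq]
    constructor
    · rintro ⟨_, a, _, rfl, h⟩; exact h
    · intro h; exact ⟨this h, x, this h, rfl, h⟩
  · intro α hα
    simp only [Finset.mem_filter, Finset.mem_univ, true_and] at hα
    obtain ⟨h1, h2⟩ := hα
    apply Finset.eq_of_subset_of_card_le
    · intro x hx
      obtain ⟨v, hv, rfl⟩ := Finset.mem_image.1 hx
      have hv' := hv
      rw [← h1, pface, Finset.mem_image] at hv'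
      obtain ⟨⟨v', s⟩, hy, rfl⟩ := hv'
      by_cases ht : (v', true) ∈ α
      · simpa [ht, hv] using ht
      · cases s
        · simpa [ht] using hy
        · exact absurd hy ht
    · rw [Finset.card_image_of_injective _ (fun a b hab => (Prod.mk.inj hab).1), hΔ, h2]
  · intro T hT
    rw [aux_mu]
    split_ifs <;> simp

theorem mu_eval_on_ODeltaM
    {V : Type} [Fintype V] [DecidableEq V] [LinearOrder V] (L : SCplx V) (k : ℕ)
    (hdim : IsDimOf L k) (M : Finset V → ZMod 2) (hM : IsCycleOn L k M)
    (Δ : Finset V) (hΔ : M Δ ≠ 0) :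
    ∑ α : Finset (V × Bool), ∑ b : Finset V,
      chODeltaM Δ M k (α, b) * ((muVal α b : ℤ) : ZMod 2) = 1 := by
  rename_i _ inst lo
  have hinst : inst = (fun a b => lo.toDecidableEq a b) := Subsingleton.elim _ _
  subst hinst
  rw [Finset.sum_comm]
  have key : ∀ b : Finset V, ∑ α : Finset (V × Bool),
      chODeltaM Δ M k (α, b) * ((muVal α b : ℤ) : ZMod 2) = if Δ = b then M b else 0 := by
    intro b
    by_cases hb : M b = 0
    · simp [chODeltaM, hb]
    · have h := aux_sum Δ b k (hM.1 Δ hΔ).2 (hM.1 b hb).2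
      rw [Finset.sum_filter] at h
      have h2 := congrArg (fun x => M b * x) h
      simp only [Finset.mul_sum, mul_ite, mul_one, mul_zero] at h2
      rw [← h2]
      refine Finset.sum_congr rfl (fun α _ => ?_)
      simp only [chODeltaM]
      split_ifs <;> simp_all
  simp only [key, Finset.sum_ite_eq, Finset.mem_univ, if_true]
  have : ∀ x : ZMod 2, x ≠ 0 → x = 1 := by decide
  exact this _ hΔ
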